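/- arXiv:2212.11239 — 2 statements merged into one kernel-verified Lean document; each statement's English description precedes it below -/
import Mathlib

section
/- Let G = (V,E) be a hypergraph expanded w.r.t. v_1, …, v_s for some s ≥ 1. For each i ∈ [s], let G̃_i be the partial hypergraph of G − v_1 − ⋯ − v_{i−1} pointed at v_i; that is, denoting by E_{v_i} the set of edges of G − v_1 − ⋯ − v_{i−1} containing v_i, listed as e_1 ⊂ e_2 ⊂ ⋯ ⊂ e_k, we set G̃_i := (e_k, E_{v_i} ∪ { e \ {v_i} : e ∈ E_{v_i}, |e \ {v_i}| ≥ 2 }). Then conv S_G = conv S̄_{G − v_1 − ⋯ − v_s} ∩ ⋂_{i ∈ [s]} conv S̄_{G̃_i}; that is, MP_G is given by a description of MP_{G − v_1 − ⋯ − v_s} together with a description of MP_{G̃_i} for all i ∈ [s]. -/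
open BigOperators

variable {α : Type*} [DecidableEq α]

/-- `(V, E)` forms a hypergraph: every edge is a subset of `V` of cardinality at least two. -/
def IsHypergraph (V : Finset α) (E : Finset (Finset α)) : Prop :=
  (∀ e ∈ E, e ⊆ V) ∧ ∀ e ∈ E, 2 ≤ e.card

/-- The multilinear set `S_G` of the hypergraph `G = (V, E)`, viewed inside the space of all
functions on node- and edge-coordinates, with all coordinates outside `V ∪ E` set to zero. -/
def mSet (V : Finset α) (E : Finset (Finset α)) : Set ((α ⊕ Finset α) → ℝ) :=
  { z | (∀ v ∈ V, z (Sum.inl v) = 0 ∨ z (Sum.inl v) = 1)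
      ∧ (∀ v, v ∉ V → z (Sum.inl v) = 0)
      ∧ (∀ e, e ∉ E → z (Sum.inr e) = 0)
      ∧ ∀ e ∈ E, z (Sum.inr e) = ∏ v ∈ e, z (Sum.inl v) }

/-- `S̄_H` for a hypergraph `H` with edge set `E₁`, inside the ambient space `{0,1}^{V ∪ E}`:
the binary points of the ambient hypergraph `(V, E)` whose restriction to the coordinates of
`H` lies in `S_H`. -/
def barSet (V : Finset α) (E E₁ : Finset (Finset α)) : Set ((α ⊕ Finset α) → ℝ) :=
  { z | (∀ v ∈ V, z (Sum.inl v) = 0 ∨ z (Sum.inl v) = 1)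
      ∧ (∀ e ∈ E, z (Sum.inr e) = 0 ∨ z (Sum.inr e) = 1)
      ∧ (∀ v, v ∉ V → z (Sum.inl v) = 0)
      ∧ (∀ e, e ∉ E → z (Sum.inr e) = 0)
      ∧ ∀ e ∈ E₁, z (Sum.inr e) = ∏ v ∈ e, z (Sum.inl v) }

/-- The variable `z_p`: the edge variable if `|p| ≥ 2`, the node variable `z_u` if `p = {u}`,
and `0` if `p = ∅`. -/
def zc (z : (α ⊕ Finset α) → ℝ) (p : Finset α) : ℝ :=
  if 2 ≤ p.card then z (Sum.inr p) else ∑ u ∈ p, z (Sum.inl u)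

/-- `v` is a nest point of `(V, E)`: the edges containing `v` are totally ordered by
inclusion. -/
def IsNestPoint (V : Finset α) (E : Finset (Finset α)) (v : α) : Prop :=
  v ∈ V ∧ ∀ e ∈ E, v ∈ e → ∀ f ∈ E, v ∈ f → e ⊆ f ∨ f ⊆ e

/-- Edge set of the hypergraph `G - v` obtained by removing the node `v`. -/
def eraseE (E : Finset (Finset α)) (v : α) : Finset (Finset α) :=
  (E.image fun e => e.erase v).filter fun p => 2 ≤ p.card

/-- Node set after removing a list of nodes. -/
def eraseListV (V : Finset α) (l : List α) : Finset α := l.foldl Finset.erase V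

/-- Edge set after removing a list of nodes. -/
def eraseListE (E : Finset (Finset α)) (l : List α) : Finset (Finset α) := l.foldl eraseE E

/-- `l` is a nest point sequence of `(V, E)`. -/
def IsNestPointSeq (V : Finset α) (E : Finset (Finset α)) (l : List α) : Prop :=
  l.Nodup ∧ ∀ i : Fin l.length,
    IsNestPoint (eraseListV V (l.take i.1)) (eraseListE E (l.take i.1)) (l.get i)

/-- `(V, E)` is expanded w.r.t. the sequence `l`. -/
def IsExpanded (V : Finset α) (E : Finset (Finset α)) (l : List α) : Prop :=
  IsNestPointSeq V E l ∧
    ∀ e ∈ E, ∀ i ≤ l.length, 2 ≤ (e \ (l.take i).toFinset).card →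
      e \ (l.take i).toFinset ∈ E

/-- Edge set of the expansion of `(V, E)` w.r.t. `l`. -/
def expansionE (E : Finset (Finset α)) (l : List α) : Finset (Finset α) :=
  E ∪ E.biUnion fun e =>
    ((Finset.range l.length).image fun i => e \ (l.take (i + 1)).toFinset).filter
      fun p => 2 ≤ p.card

/-- The hypergraph with edge set `E` contains a β-cycle (of length `t + 3 ≥ 3`). -/
def HasBetaCycle (E : Finset (Finset α)) : Prop :=
  ∃ t : ℕ, ∃ v : Fin (t + 3) → α, ∃ e : Fin (t + 3) → Finset α,
    Function.Injective v ∧ Function.Injective e ∧ (∀ i, e i ∈ E) ∧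
      ∀ i j : Fin (t + 3), v i ∈ e j ↔ (j = i ∨ j = i - 1)

/-- The hypergraph with edge set `E` is β-acyclic. -/
def IsBetaAcyclic (E : Finset (Finset α)) : Prop := ¬ HasBetaCycle E

/-- The product `a · z` over the coordinates indexed by `V ∪ E`. -/
def dotp (V : Finset α) (E : Finset (Finset α)) (a z : (α ⊕ Finset α) → ℝ) : ℝ :=
  (∑ u ∈ V, a (Sum.inl u) * z (Sum.inl u)) + ∑ f ∈ E, a (Sum.inr f) * z (Sum.inr f)

/-- The inequality `a · z ≤ b` is valid for the multilinear polytope of `(V, E)`. -/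
def IsValidIneq (V : Finset α) (E : Finset (Finset α)) (a : (α ⊕ Finset α) → ℝ)
    (b : ℝ) : Prop :=
  ∀ z ∈ convexHull ℝ (mSet V E), dotp V E a z ≤ b

/-- The inequality `a · z ≤ b` defines a facet of the multilinear polytope of `(V, E)`:
it is valid and the face it induces has affine dimension `|V| + |E| - 1`. -/
def IsFacetIneq (V : Finset α) (E : Finset (Finset α)) (a : (α ⊕ Finset α) → ℝ)
    (b : ℝ) : Prop :=
  IsValidIneq V E a b ∧
    Module.finrank ℝ
        (affineSpan ℝ {z ∈ convexHull ℝ (mSet V E) | dotp V E a z = b}).direction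
      = V.card + E.card - 1

/-- Restriction of a point to the coordinates indexed by `V' ∪ E'` (zero elsewhere). -/
def restrictTo (V' : Finset α) (E' : Finset (Finset α)) (z : (α ⊕ Finset α) → ℝ) :
    (α ⊕ Finset α) → ℝ
  | Sum.inl u => if u ∈ V' then z (Sum.inl u) else 0
  | Sum.inr f => if f ∈ E' then z (Sum.inr f) else 0

/-- The set `N(p_j) = p_j ∩ (⋃_{i < j} p_i)` induced by a running intersection ordering. -/
def Nfun {m : ℕ} (p : Fin m → Finset α) (j : Fin m) : Finset α :=
  p j ∩ (Finset.univ.filter fun i => i < j).biUnion p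

/-- The standard linearization `MP^LP` of `(V, E)` (with coordinates outside `V ∪ E` set to
zero). -/
def stdLin (V : Finset α) (E : Finset (Finset α)) : Set ((α ⊕ Finset α) → ℝ) :=
  { z | (∀ v, v ∉ V → z (Sum.inl v) = 0)
      ∧ (∀ e, e ∉ E → z (Sum.inr e) = 0)
      ∧ (∀ v ∈ V, z (Sum.inl v) ≤ 1)
      ∧ ∀ e ∈ E, 0 ≤ z (Sum.inr e)
          ∧ (∑ v ∈ e, z (Sum.inl v)) - (e.card : ℝ) + 1 ≤ z (Sum.inr e)
          ∧ ∀ v ∈ e, z (Sum.inr e) ≤ z (Sum.inl v) }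

/-- `S` is the half-space of an extended running intersection inequality of `(V, E)`. -/
def IsERIHalfspace (V : Finset α) (E : Finset (Finset α))
    (S : Set ((α ⊕ Finset α) → ℝ)) : Prop :=
  ∃ (t m : ℕ) (e₀ : Finset α) (eK : Fin t → Finset α) (p : Fin m → Finset α)
      (idx : Fin t → Fin m) (w : Fin t → Finset α),
    e₀ ∈ E ∧ (∀ k, eK k ∈ E) ∧ (∀ k, (e₀ ∩ eK k).Nonempty) ∧
      Function.Injective p ∧ (∀ j, ∃ k, p j = e₀ ∩ eK k) ∧
      (∀ k, p (idx k) = e₀ ∩ eK k) ∧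
      (∀ j : Fin m, 0 < (j : ℕ) → ∃ j' : Fin m, j' < j ∧ Nfun p j ⊆ p j') ∧
      (∀ k, w k ⊆ Nfun p (idx k) ∧ (w k = ∅ ∨ (∃ u ∈ V, w k = {u}) ∨ w k ∈ E)) ∧
      S = { z | - (∑ k : Fin t, zc z (w k))
            + (∑ u ∈ e₀ \ Finset.univ.biUnion eK, z (Sum.inl u))
            + (∑ k : Fin t, z (Sum.inr (eK k))) - z (Sum.inr e₀)
          ≤ ((e₀ \ Finset.univ.biUnion eK).card : ℝ)
            + ((Finset.univ.filter fun k : Fin t => Nfun p (idx k) = ∅).card : ℝ) - 1 }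

/-- The extended running intersection relaxation `MP^ERI` of `(V, E)`. -/
def MPERI (V : Finset α) (E : Finset (Finset α)) : Set ((α ⊕ Finset α) → ℝ) :=
  stdLin V E ∩ ⋂₀ { S | IsERIHalfspace V E S }

/-- Two finite nonnegative weightings with the same label distribution have a coupling supported
on pairs with equal labels. -/
theorem exists_coupling {I K κ : Type*} [Fintype I] [Fintype K] [DecidableEq κ]
    (a : I → ℝ) (b : K → ℝ) (ha : ∀ i, 0 ≤ a i) (hb : ∀ k, 0 ≤ b k) (r : I → κ) (s : K → κ)
    (hrs : ∀ c, ∑ i, (if r i = c then a i else 0) = ∑ k, if s k = c then b k else 0) :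
    ∃ w : I → K → ℝ, (∀ i k, 0 ≤ w i k) ∧ (∀ i k, r i ≠ s k → w i k = 0) ∧
      (∀ i, ∑ k, w i k = a i) ∧ ∀ k, ∑ i, w i k = b k := by
  set p : κ → ℝ := fun c => ∑ i, if r i = c then a i else 0 with hp
  have hp0 : ∀ c, 0 ≤ p c := fun c =>
    Finset.sum_nonneg fun i _ => by split_ifs <;> simp [ha]
  have hap : ∀ i, a i ≤ p (r i) := fun i => by
    have := Finset.single_le_sum (f := fun j => if r j = r i then a j else 0)
      (fun j _ => by split_ifs <;> simp [ha]) (Finset.mem_univ i)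
    simpa using this
  have hbp : ∀ k, b k ≤ p (s k) := fun k => by
    have := Finset.single_le_sum (f := fun j => if s j = s k then b j else 0)
      (fun j _ => by split_ifs <;> simp [hb]) (Finset.mem_univ k)
    simpa [hp, hrs] using this
  refine ⟨fun i k => if r i = s k then a i * b k / p (r i) else 0, fun i k => ?_,
    fun i k h => if_neg h, fun i => ?_, fun k => ?_⟩
  · dsimp only
    split_ifs
    · exact div_nonneg (mul_nonneg (ha i) (hb k)) (hp0 _)
    · exact le_rfl
  · have h : ∑ k, (if r i = s k then a i * b k / p (r i) else 0) =
        a i / p (r i) * ∑ k, if s k = r i then b k else 0 := by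
      rw [Finset.mul_sum]
      refine Finset.sum_congr rfl fun k _ => ?_
      by_cases hk : r i = s k
      · simp only [hk, if_true]; ring
      · simp [hk, Ne.symm hk]
    rw [h, ← hrs]
    rcases (hp0 (r i)).eq_or_lt with h0 | h0
    · have : a i = 0 := le_antisymm (h0 ▸ hap i) (ha i)
      simp [this]
    · exact div_mul_cancel₀ _ h0.ne'
  · have h : ∑ i, (if r i = s k then a i * b k / p (r i) else 0) =
        b k / p (s k) * p (s k) := by
      rw [hp, Finset.mul_sum]
      refine Finset.sum_congr rfl fun i _ => ?_
      by_cases hk : r i = s k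
      · simp only [hk, if_true]; ring
      · simp [hk]
    rw [h]
    rcases (hp0 (s k)).eq_or_lt with h0 | h0
    · have : b k = 0 := le_antisymm (h0 ▸ hbp k) (hb k)
      simp [this]
    · exact div_mul_cancel₀ _ h0.ne'

/-- If points of `S` and `T` with equal labels can be glued along `D` to a point of `U`, and the
label indicators are affine on `S ∪ T`, then a common point of the convex hulls of `S` and `T`
lies in the convex hull of `U`. -/
theorem mem_convexHull_of_glue {ι κ : Type*} [DecidableEq κ] {S T U : Set (ι → ℝ)}
    (D : ι → Prop) [DecidablePred D] (J : (ι → ℝ) → κ)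
    (hJ : ∀ c, ∃ (L : (ι → ℝ) →ₗ[ℝ] ℝ) (b : ℝ), ∀ x ∈ S ∪ T,
      (if J x = c then (1 : ℝ) else 0) = L x + b)
    (hU : ∀ x ∈ S, ∀ y ∈ T, J x = J y → (fun j => if D j then y j else x j) ∈ U)
    {z : ι → ℝ} (hS : z ∈ convexHull ℝ S) (hT : z ∈ convexHull ℝ T) :
    z ∈ convexHull ℝ U := by
  rw [mem_convexHull_iff_exists_fintype] at hS hT
  obtain ⟨I, _, a, x, ha, ha1, hx, hxz⟩ := hS
  obtain ⟨K, _, b, y, hb, hb1, hy, hyz⟩ := hT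
  choose L β hL using hJ
  have key : ∀ (c : κ) (M : Type) [Fintype M] (m : M → ℝ) (q : M → ι → ℝ), ∑ i, m i = 1 →
      (∀ i, q i ∈ S ∪ T) → ∑ i, m i • q i = z →
      ∑ i, (if J (q i) = c then m i else 0) = L c z + β c := by
    intro c M _ m q hm hq hz
    rw [← hz, map_sum, ← one_mul (β c), ← hm, Finset.sum_mul, ← Finset.sum_add_distrib]
    refine Finset.sum_congr rfl fun i _ => ?_
    rw [map_smul, smul_eq_mul, ← mul_add, ← hL c _ (hq i)]
    simp
  obtain ⟨w, hw0, hwne, hwa, hwb⟩ := exists_coupling a b ha hb (fun i => J (x i))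
    (fun k => J (y k)) fun c => by
      rw [key c I a x ha1 (fun i => Or.inl (hx i)) hxz,
        key c K b y hb1 (fun k => Or.inr (hy k)) hyz]
  have hsupp : ∀ f : I × K → ℝ, ∑ p with J (x p.1) = J (y p.2), w p.1 p.2 * f p =
      ∑ i, ∑ k, w i k * f (i, k) := by
    intro f
    rw [← Fintype.sum_prod_type', Finset.sum_filter]
    refine Finset.sum_congr rfl fun p _ => ?_
    split_ifs with h
    · rfl
    · rw [hwne _ _ h, zero_mul]
  have hz : z = ∑ p : I × K with J (x p.1) = J (y p.2),
      w p.1 p.2 • (fun j => if D j then y p.2 j else x p.1 j) := by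
    funext j
    simp only [Finset.sum_apply, Pi.smul_apply, smul_eq_mul]
    rw [hsupp fun p => if D j then y p.2 j else x p.1 j]
    split_ifs
    · rw [Finset.sum_comm, ← hyz]
      simp [← Finset.sum_mul, hwb]
    · rw [← hxz]
      simp [← Finset.sum_mul, hwa]
  rw [hz]
  refine (convex_convexHull ℝ U).sum_mem (fun p _ => hw0 _ _) ?_ fun p hp =>
    subset_convexHull ℝ U (hU _ (hx _) _ (hy _) (Finset.mem_filter.1 hp).2)
  have := hsupp fun _ => 1
  simpa [hwa, ha1] using this

/-- `zc` as a linear functional. -/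
def zcLin (p : Finset α) : ((α ⊕ Finset α) → ℝ) →ₗ[ℝ] ℝ :=
  if 2 ≤ p.card then LinearMap.proj (Sum.inr p) else ∑ u ∈ p, LinearMap.proj (Sum.inl u)

theorem zcLin_apply (p : Finset α) (z : (α ⊕ Finset α) → ℝ) : zcLin p z = zc z p := by
  unfold zcLin zc
  split_ifs <;> simp

theorem zc_eq_prod {V : Finset α} {E E₁ : Finset (Finset α)} {z : (α ⊕ Finset α) → ℝ}
    (hz : z ∈ barSet V E E₁) {p : Finset α} (hp : p.Nonempty) (h : 2 ≤ p.card → p ∈ E₁) :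
    zc z p = ∏ u ∈ p, z (Sum.inl u) := by
  unfold zc
  split_ifs with h2
  · exact hz.2.2.2.2 p (h h2)
  · obtain ⟨u, rfl⟩ := Finset.card_eq_one.1 (show p.card = 1 by have := hp.card_pos; omega)
    simp

theorem prod_binary {ι : Type*} {f : ι → ℝ} {s : Finset ι} (h : ∀ i ∈ s, f i = 0 ∨ f i = 1) :
    ∏ i ∈ s, f i = 0 ∨ ∏ i ∈ s, f i = 1 := by
  by_cases h0 : ∃ i ∈ s, f i = 0
  · obtain ⟨i, hi, h0⟩ := h0
    exact Or.inl (Finset.prod_eq_zero hi h0)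
  · push Not at h0
    exact Or.inr (Finset.prod_eq_one fun i hi => (h i hi).resolve_left (h0 i hi))

/-- Products of chain coordinates and complements of chain coordinates are affine on the points
whose chain coordinates are monomials. -/
theorem exists_affine_chain (Q : Finset (Finset α))
    (hQ : ∀ p ∈ Q, ∀ q ∈ Q, p ⊆ q ∨ q ⊆ p) {X : Set ((α ⊕ Finset α) → ℝ)}
    (hX : ∀ x ∈ X, ∀ q ∈ Q, zc x q = ∏ u ∈ q, x (Sum.inl u))
    (hb : ∀ x ∈ X, ∀ q ∈ Q, ∀ u ∈ q, x (Sum.inl u) = 0 ∨ x (Sum.inl u) = 1)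
    (d : Finset (Finset α)) : ∀ c ⊆ Q, d ⊆ Q →
    ∃ (L : ((α ⊕ Finset α) → ℝ) →ₗ[ℝ] ℝ) (b : ℝ), ∀ x ∈ X,
      (∏ q ∈ c, zc x q) * ∏ q ∈ d, (1 - zc x q) = L x + b := by
  induction d using Finset.induction_on with
  | empty =>
    intro c hc _
    rcases c.eq_empty_or_nonempty with rfl | hne
    · exact ⟨0, 1, fun x _ => by simp⟩
    obtain ⟨m, hm, hmax⟩ := c.exists_max_image Finset.card hne
    refine ⟨zcLin m, 0, fun x hx => ?_⟩
    rw [zcLin_apply, Finset.prod_empty, mul_one, add_zero, ← Finset.mul_prod_erase c _ hm]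
    have hle : ∀ q ∈ c, q ⊆ m := fun q hq =>
      (hQ q (hc hq) m (hc hm)).elim id fun h =>
        (Finset.eq_of_subset_of_card_le h (hmax q hq)).symm.subset
    have hbin : ∀ u ∈ m, x (Sum.inl u) = 0 ∨ x (Sum.inl u) = 1 := hb x hx m (hc hm)
    by_cases h0 : ∃ u ∈ m, x (Sum.inl u) = 0
    · obtain ⟨u, hu, h0⟩ := h0
      rw [hX x hx m (hc hm), Finset.prod_eq_zero hu h0, zero_mul]
    · push Not at h0
      rw [Finset.prod_eq_one (s := c.erase m), mul_one]
      intro q hq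
      have hqc := Finset.mem_of_mem_erase hq
      rw [hX x hx q (hc hqc)]
      exact Finset.prod_eq_one fun u hu =>
        (hbin u (hle q hqc hu)).resolve_left (h0 u (hle q hqc hu))
  | insert q d hqd ih =>
    intro c hc hd
    obtain ⟨hq, hd⟩ := Finset.insert_subset_iff.1 hd
    obtain ⟨L₁, b₁, h₁⟩ := ih c hc hd
    by_cases hqc : q ∈ c
    · refine ⟨0, 0, fun x hx => ?_⟩
      have hzc : zc x q = 0 ∨ zc x q = 1 := by
        rw [hX x hx q hq]
        exact prod_binary (hb x hx q hq)
      rw [Finset.prod_insert hqd, ← Finset.mul_prod_erase c _ hqc]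
      rcases hzc with h | h <;> simp [h]
    · obtain ⟨L₂, b₂, h₂⟩ := ih (insert q c) (Finset.insert_subset hq hc) hd
      refine ⟨L₁ - L₂, b₁ - b₂, fun x hx => ?_⟩
      have e₁ := h₁ x hx
      have e₂ := h₂ x hx
      rw [Finset.prod_insert hqc] at e₂
      rw [Finset.prod_insert hqd, LinearMap.sub_apply]
      linear_combination e₁ - e₂

/-- The edges of the partial hypergraph pointed at `v`. -/
def pointedE (E : Finset (Finset α)) (v : α) : Finset (Finset α) :=
  (E.filter fun f => v ∈ f) ∪
    ((E.filter fun f => v ∈ f).image fun f => f.erase v).filter fun p => 2 ≤ p.card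

theorem mem_convexHull_barSet_of_nestPoint {V : Finset α} {E F : Finset (Finset α)}
    (hF : IsHypergraph V F) {v : α}
    (hv : ∀ e ∈ F, v ∈ e → ∀ f ∈ F, v ∈ f → e ⊆ f ∨ f ⊆ e)
    {z : (α ⊕ Finset α) → ℝ} (hA : z ∈ convexHull ℝ (barSet V E (eraseE F v)))
    (hB : z ∈ convexHull ℝ (barSet V E (pointedE F v))) :
    z ∈ convexHull ℝ (barSet V E F) := by
  classical
  set Q : Finset (Finset α) := (F.filter fun f => v ∈ f).image fun f => f.erase v with hQdef
  have hQ : ∀ q ∈ Q, ∃ e ∈ F, v ∈ e ∧ e.erase v = q := fun q hq => by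
    simpa [hQdef, and_assoc] using hq
  have hQV : ∀ q ∈ Q, q ⊆ V := fun q hq => by
    obtain ⟨e, he, -, rfl⟩ := hQ q hq
    exact (Finset.erase_subset _ _).trans (hF.1 e he)
  have hQchain : ∀ p ∈ Q, ∀ q ∈ Q, p ⊆ q ∨ q ⊆ p := fun p hp q hq => by
    obtain ⟨e, he, hve, rfl⟩ := hQ p hp
    obtain ⟨f, hf, hvf, rfl⟩ := hQ q hq
    exact (hv e he hve f hf hvf).imp (Finset.erase_subset_erase v) (Finset.erase_subset_erase v)
  have hQne : ∀ q ∈ Q, q.Nonempty := fun q hq => by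
    obtain ⟨e, he, hve, rfl⟩ := hQ q hq
    rw [← Finset.card_pos, Finset.card_erase_of_mem hve]
    have := hF.2 e he
    omega
  have hQA : ∀ q ∈ Q, 2 ≤ q.card → q ∈ eraseE F v := fun q hq h2 => by
    obtain ⟨e, he, hve, rfl⟩ := hQ q hq
    exact Finset.mem_filter.2 ⟨Finset.mem_image_of_mem _ he, h2⟩
  have hQB : ∀ q ∈ Q, 2 ≤ q.card → q ∈ pointedE F v := fun q hq h2 =>
    Finset.mem_union_right _ (Finset.mem_filter.2 ⟨hq, h2⟩)
  have hzA : ∀ x ∈ barSet V E (eraseE F v), ∀ q ∈ Q, zc x q = ∏ u ∈ q, x (Sum.inl u) :=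
    fun x hx q hq => zc_eq_prod hx (hQne q hq) (hQA q hq)
  have hzB : ∀ x ∈ barSet V E (pointedE F v), ∀ q ∈ Q, zc x q = ∏ u ∈ q, x (Sum.inl u) :=
    fun x hx q hq => zc_eq_prod hx (hQne q hq) (hQB q hq)
  have hX : ∀ x ∈ barSet V E (eraseE F v) ∪ barSet V E (pointedE F v), ∀ q ∈ Q,
      zc x q = ∏ u ∈ q, x (Sum.inl u) := fun x hx => hx.elim (hzA x) (hzB x)
  have hb : ∀ x ∈ barSet V E (eraseE F v) ∪ barSet V E (pointedE F v), ∀ q ∈ Q, ∀ u ∈ q,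
      x (Sum.inl u) = 0 ∨ x (Sum.inl u) = 1 := fun x hx q hq u hu =>
    hx.elim (fun h => h.1 u (hQV q hq hu)) fun h => h.1 u (hQV q hq hu)
  have hzc : ∀ x ∈ barSet V E (eraseE F v) ∪ barSet V E (pointedE F v), ∀ q ∈ Q,
      zc x q = 0 ∨ zc x q = 1 := fun x hx q hq => by
    rw [hX x hx q hq]
    exact prod_binary (hb x hx q hq)
  refine mem_convexHull_of_glue (S := barSet V E (eraseE F v))
    (T := barSet V E (pointedE F v))
    (fun j => j = Sum.inl v ∨ ∃ e ∈ F, v ∈ e ∧ j = Sum.inr e)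
    (fun x => Q.filter fun q => zc x q = 1) (fun c => ?_) (fun x hx y hy hxy => ?_) hA hB
  · by_cases hc : c ⊆ Q
    · obtain ⟨L, b, h⟩ := exists_affine_chain Q hQchain hX hb (Q \ c) c hc Finset.sdiff_subset
      refine ⟨L, b, fun x hx => ?_⟩
      rw [← h x hx]
      split_ifs with heq
      · rw [Finset.prod_eq_one, Finset.prod_eq_one, one_mul]
        · intro q hq
          obtain ⟨hqQ, hqc⟩ := Finset.mem_sdiff.1 hq
          rw [(hzc x hx q hqQ).resolve_right fun h1 =>
            hqc (heq ▸ Finset.mem_filter.2 ⟨hqQ, h1⟩), sub_zero]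
        · intro q hq
          rw [← heq] at hq
          exact (Finset.mem_filter.1 hq).2
      · by_contra hne
        have hne := mul_ne_zero_iff.1 (Ne.symm hne)
        rw [Finset.prod_ne_zero_iff, Finset.prod_ne_zero_iff] at hne
        refine heq (Finset.ext fun q => ⟨fun hq => ?_, fun hq => ?_⟩)
        · obtain ⟨hqQ, h1⟩ := Finset.mem_filter.1 hq
          by_contra hqc
          exact hne.2 q (Finset.mem_sdiff.2 ⟨hqQ, hqc⟩) (by rw [h1, sub_self])
        · exact Finset.mem_filter.2
            ⟨hc hq, (hzc x hx q (hc hq)).resolve_left (hne.1 q hq)⟩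
    · refine ⟨0, 0, fun x _ => ?_⟩
      rw [if_neg]
      · simp
      · rintro rfl
        exact hc (Finset.filter_subset _ _)
  · have hxyzc : ∀ q ∈ Q, zc x q = zc y q := fun q hq => by
      have h := Finset.ext_iff.1 hxy q
      simp only [Finset.mem_filter, hq, true_and] at h
      rcases hzc x (Or.inl hx) q hq with h0 | h1
      · rcases hzc y (Or.inr hy) q hq with h0' | h1'
        · rw [h0, h0']
        · rw [h.2 h1', h1']
      · rw [h1, h.1 h1]
    refine ⟨fun u hu => ?_, fun e he => ?_, fun u hu => ?_, fun e he => ?_, fun e he => ?_⟩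
    · exact iteInduction (motive := fun r => r = 0 ∨ r = 1) (fun _ => hy.1 u hu)
        fun _ => hx.1 u hu
    · exact iteInduction (motive := fun r => r = 0 ∨ r = 1) (fun _ => hy.2.1 e he)
        fun _ => hx.2.1 e he
    · exact iteInduction (motive := fun r => r = 0) (fun _ => hy.2.2.1 u hu)
        fun _ => hx.2.2.1 u hu
    · exact iteInduction (motive := fun r => r = 0) (fun _ => hy.2.2.2.1 e he)
        fun _ => hx.2.2.2.1 e he
    · by_cases hve : v ∈ e
      · have hq : e.erase v ∈ Q :=
          Finset.mem_image_of_mem _ (Finset.mem_filter.2 ⟨he, hve⟩)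
        have hye := hy.2.2.2.2 e (Finset.mem_union_left _ (Finset.mem_filter.2 ⟨he, hve⟩))
        beta_reduce
        rw [if_pos (Or.inr ⟨e, he, hve, rfl⟩), hye, ← Finset.mul_prod_erase e _ hve,
          ← Finset.mul_prod_erase e _ hve, ← hzB y hy _ hq, ← hxyzc _ hq, hzA x hx _ hq]
        simp only [true_or, if_true]
        congr 1
        refine Finset.prod_congr rfl fun u hu => ?_
        simp [Finset.ne_of_mem_erase hu]
      · have hmem : e ∈ eraseE F v := Finset.mem_filter.2
          ⟨Finset.mem_image.2 ⟨e, he, Finset.erase_eq_of_notMem hve⟩, hF.2 e he⟩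
        beta_reduce
        rw [if_neg, hx.2.2.2.2 e hmem]
        · refine Finset.prod_congr rfl fun u hu => ?_
          have : u ≠ v := fun h => hve (h ▸ hu)
          simp [this]
        · rintro (h | ⟨f, -, hvf, h⟩)
          · cases h
          · cases h
            exact hve hvf

theorem IsHypergraph.eraseE {V : Finset α} {F : Finset (Finset α)} (hF : IsHypergraph V F)
    (v : α) : IsHypergraph V (eraseE F v) := by
  refine ⟨fun e he => ?_, fun e he => (Finset.mem_filter.1 he).2⟩
  obtain ⟨f, hf, rfl⟩ := Finset.mem_image.1 (Finset.mem_filter.1 he).1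
  exact (Finset.erase_subset _ _).trans (hF.1 f hf)

theorem mem_convexHull_barSet_of_nestPointSeq {V : Finset α} {E : Finset (Finset α)}
    {z : (α ⊕ Finset α) → ℝ} (l : List α) : ∀ F : Finset (Finset α), IsHypergraph V F →
    (∀ i : Fin l.length, ∀ e ∈ eraseListE F (l.take i.1), l.get i ∈ e →
      ∀ f ∈ eraseListE F (l.take i.1), l.get i ∈ f → e ⊆ f ∨ f ⊆ e) →
    z ∈ convexHull ℝ (barSet V E (eraseListE F l)) →
    (∀ i : Fin l.length,
      z ∈ convexHull ℝ (barSet V E (pointedE (eraseListE F (l.take i.1)) (l.get i)))) →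
    z ∈ convexHull ℝ (barSet V E F) := by
  induction l with
  | nil => exact fun F _ _ hz _ => hz
  | cons v l ih =>
    intro F hF hnest hz hzp
    exact mem_convexHull_barSet_of_nestPoint hF (hnest ⟨0, Nat.succ_pos _⟩)
      (ih (eraseE F v) (hF.eraseE v) (fun i => hnest i.succ) hz fun i => hzp i.succ)
      (hzp ⟨0, Nat.succ_pos _⟩)

theorem exists_sdiff_of_mem_eraseListE (l : List α) : ∀ {F : Finset (Finset α)} {f : Finset α},
    f ∈ eraseListE F l → ∃ e ∈ F, e \ l.toFinset = f := by
  induction l with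
  | nil => exact fun {F f} hf => ⟨f, hf, by simp⟩
  | cons v l ih =>
    intro F f hf
    obtain ⟨e, he, rfl⟩ := ih (F := eraseE F v) hf
    obtain ⟨e', he', rfl⟩ := Finset.mem_image.1 (Finset.mem_filter.1 he).1
    refine ⟨e', he', ?_⟩
    ext u
    simp only [Finset.mem_sdiff, Finset.mem_erase, List.toFinset_cons, Finset.mem_insert]
    tauto

theorem isHypergraph_eraseListE {V : Finset α} (l : List α) : ∀ {F : Finset (Finset α)},
    IsHypergraph V F → IsHypergraph V (eraseListE F l) := by
  induction l with
  | nil => exact fun hF => hF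
  | cons v l ih => exact fun hF => ih (hF.eraseE v)

theorem eraseListE_take_subset {V : Finset α} {E : Finset (Finset α)} {l : List α}
    (hG : IsHypergraph V E) (hexp : IsExpanded V E l) {i : ℕ} (hi : i ≤ l.length) :
    eraseListE E (l.take i) ⊆ E := by
  intro f hf
  have h2 := (isHypergraph_eraseListE (l.take i) hG).2 f hf
  obtain ⟨e, he, rfl⟩ := exists_sdiff_of_mem_eraseListE _ hf
  exact hexp.2 e he i hi h2

theorem mSet_subset_barSet {V : Finset α} {E E₁ : Finset (Finset α)} (hG : IsHypergraph V E)
    (h : E₁ ⊆ E) : mSet V E ⊆ barSet V E E₁ := by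
  rintro z ⟨hV, hV', hE', hE⟩
  refine ⟨hV, fun e he => ?_, hV', hE', fun e he => hE e (h he)⟩
  rw [hE e he]
  exact prod_binary fun u hu => hV u (hG.1 e he hu)

theorem pointedE_subset (F : Finset (Finset α)) (v : α) : pointedE F v ⊆ F ∪ eraseE F v := by
  refine Finset.union_subset_union (Finset.filter_subset _ _) ?_
  exact Finset.filter_subset_filter _ (Finset.image_subset_image (Finset.filter_subset _ _))

theorem eraseListE_take_succ (F : Finset (Finset α)) (l : List α) (i : Fin l.length) :
    eraseListE F (l.take (i.1 + 1)) = eraseE (eraseListE F (l.take i.1)) (l.get i) := by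
  rw [eraseListE, List.take_succ_eq_append_getElem i.2, List.foldl_append]
  rfl

/-- description of the multilinear polytope of an expanded hypergraph via
the pointed partial hypergraphs and the remaining hypergraph. -/
theorem expanded_decomposition
    (V : Finset α) (E : Finset (Finset α)) (hG : IsHypergraph V E)
    (l : List α) (hs : 1 ≤ l.length) (hexp : IsExpanded V E l) :
    convexHull ℝ (mSet V E) =
      convexHull ℝ (barSet V E (eraseListE E l)) ∩
        ⋂ i : Fin l.length,
          convexHull ℝ (barSet V E
            (((eraseListE E (l.take i.1)).filter fun f => l.get i ∈ f) ∪
              (((eraseListE E (l.take i.1)).filter fun f => l.get i ∈ f).image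
                  (fun f => f.erase (l.get i))).filter fun p => 2 ≤ p.card)) := by
  refine Set.Subset.antisymm (Set.subset_inter ?_ (Set.subset_iInter fun i => ?_)) ?_
  · refine convexHull_mono (mSet_subset_barSet hG ?_)
    simpa using eraseListE_take_subset hG hexp le_rfl
  · refine convexHull_mono (mSet_subset_barSet hG ((pointedE_subset _ _).trans ?_))
    rw [← eraseListE_take_succ]
    exact Finset.union_subset (eraseListE_take_subset hG hexp i.2.le)
      (eraseListE_take_subset hG hexp i.2)
  · rintro z ⟨hz, hzp⟩
    have hsub : barSet V E E ⊆ mSet V E := fun x hx =>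
      ⟨hx.1, hx.2.2.1, hx.2.2.2.1, hx.2.2.2.2⟩
    exact convexHull_mono hsub
      (mem_convexHull_barSet_of_nestPointSeq (E := E) l E hG (fun i => (hexp.1.2 i).2) hz
        (Set.mem_iInter.1 hzp))
end

section
/- Let G = (V,E) be a β-acyclic hypergraph expanded w.r.t. v_1, …, v_n, where n = |V|. For every e ∈ E, let v(e) be the first node in the sequence v_1, …, v_n contained in e, and define p(e) := e \ {v(e)}. Define M := { e ∈ E : there exists g ∈ E with g ⊂ e and v(e) ∈ g }. For every e ∈ M, let f(e) ⊂ e be the unique edge of maximum cardinality with v(e) ∈ f(e), and let f'(e) := f(e) \ {v(e)}. Let Ē := { e ∈ E : there is no g ∈ E with g ⊃ e } be the set of maximal edges. Then MP_G is exactly the set of z ∈ ℝ^{V ∪ E} satisfying: 0 ≤ z_u ≤ 1 for all u ∈ V; z_e ≥ 0 for all e ∈ Ē; z_e − z_{p(e)} ≤ 0 for all e ∈ E; z_e − z_{f(e)} ≤ 0 for all e ∈ M; −z_{f'(e)} + z_{p(e)} + z_{f(e)} − z_e ≤ 0 for all e ∈ M; z_{v(e)} + z_{p(e)} − z_e ≤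 1 for all e ∈ E \ M; and z_e − z_{v(e)} ≤ 0 for all e ∈ E \ M (where for a singleton set {u}, z_{{u}} denotes the node variable z_u). -/
open BigOperators

variable {α : Type*} [DecidableEq α]

/-- Given nonnegative weights `w` and a chain `C` with prescribed masses `a c`, the weights can be
thinned to weights `w₁` giving mass `a c` to the sets above each `c ∈ C`, provided that both `a`
and the complementary masses are nonnegative and decrease along the chain. -/
theorem exists_thinning (P : Finset (Finset α)) (w : Finset α → ℝ) (hw : ∀ T, 0 ≤ w T)
    (a W : Finset α → ℝ) (C : Finset (Finset α))
    (hW : ∀ c ∈ C, ∑ T ∈ P, (if c ⊆ T then w T else 0) = W c)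
    (hchain : ∀ c ∈ C, ∀ d ∈ C, c ⊆ d ∨ d ⊆ c)
    (h0 : ∀ c ∈ C, 0 ≤ a c ∧ a c ≤ W c)
    (hmono : ∀ c ∈ C, ∀ d ∈ C, c ⊆ d → a d ≤ a c ∧ W d - a d ≤ W c - a c) :
    ∃ w₁ : Finset α → ℝ, (∀ T, 0 ≤ w₁ T ∧ w₁ T ≤ w T) ∧
      (∀ T, (∀ c ∈ C, ¬ c ⊆ T) → w₁ T = 0) ∧
      ∀ c ∈ C, ∑ T ∈ P, (if c ⊆ T then w₁ T else 0) = a c := by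
  induction C using Finset.induction_on_min_value (fun c : Finset α => c.card) with
  | empty => exact ⟨fun _ => 0, by simpa using hw, by simp, by simp⟩
  | insert c s hcs hmin ih =>
    obtain ⟨w₁, hb, hsupp, hsum⟩ := ih
      (fun d hd => hW d (Finset.mem_insert_of_mem hd))
      (fun d hd e he => hchain d (Finset.mem_insert_of_mem hd) e (Finset.mem_insert_of_mem he))
      (fun d hd => h0 d (Finset.mem_insert_of_mem hd))
      (fun d hd e he => hmono d (Finset.mem_insert_of_mem hd) e (Finset.mem_insert_of_mem he))
    have hc := Finset.mem_insert_self c s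
    have hsub : ∀ {d e : Finset α}, d ∈ insert c s → e ∈ insert c s → d.card ≤ e.card → d ⊆ e := by
      intro d e hd he hde
      rcases hchain d hd e he with h | h
      · exact h
      · exact (Finset.eq_of_subset_of_card_le h hde).ge
    have hcd : ∀ d ∈ s, c ⊆ d := fun d hd =>
      hsub hc (Finset.mem_insert_of_mem hd) (hmin d hd)
    have key : ∃ A B : ℝ, ∑ T ∈ P, (if c ⊆ T then w₁ T else 0) = A ∧
        ∑ T ∈ P, (if c ⊆ T ∧ ∀ d ∈ s, ¬ d ⊆ T then w T else 0) = W c - B ∧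
        A ≤ a c ∧ W c - a c ≥ B - A := by
      rcases s.eq_empty_or_nonempty with rfl | hne
      · refine ⟨0, 0, ?_, ?_, (h0 c hc).1, by linarith [(h0 c hc).2]⟩
        · exact Finset.sum_eq_zero fun T _ => by rw [hsupp T (by simp)]; simp
        · simpa using hW c hc
      · obtain ⟨m, hm, hmm⟩ := s.exists_min_image (fun c : Finset α => c.card) hne
        have hms : ∀ d ∈ s, m ⊆ d := fun d hd =>
          hsub (Finset.mem_insert_of_mem hm) (Finset.mem_insert_of_mem hd) (hmm d hd)
        have hmo := hmono c hc m (Finset.mem_insert_of_mem hm) (hcd m hm)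
        have hiff : ∀ T, (∀ d ∈ s, ¬ d ⊆ T) ↔ ¬ m ⊆ T := fun T =>
          ⟨fun h => h m hm, fun h d hd hdT => h ((hms d hd).trans hdT)⟩
        refine ⟨a m, W m, ?_, ?_, hmo.1, hmo.2⟩
        · rw [← hsum m hm]
          refine Finset.sum_congr rfl fun T _ => ?_
          by_cases hmT : m ⊆ T
          · rw [if_pos hmT, if_pos ((hcd m hm).trans hmT)]
          · rw [hsupp T ((hiff T).2 hmT)]; simp
        · rw [← hW c hc, ← hW m (Finset.mem_insert_of_mem hm), ← Finset.sum_sub_distrib]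
          refine Finset.sum_congr rfl fun T _ => ?_
          simp only [hiff]
          by_cases hmT : m ⊆ T
          · simp [hmT, (hcd m hm).trans hmT]
          · simp [hmT]
    obtain ⟨A, B, hA, hB, hAa, hAB⟩ := key
    have hratio : ∃ r : ℝ, 0 ≤ r ∧ r ≤ 1 ∧ (W c - B) * r = a c - A := by
      rcases eq_or_ne (W c - B) 0 with h | h
      · exact ⟨0, le_rfl, zero_le_one, by rw [mul_zero]; linarith⟩
      · have hpos : 0 < W c - B := lt_of_le_of_ne (by linarith) h.symm
        exact ⟨(a c - A) / (W c - B), div_nonneg (by linarith) hpos.le,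
          (div_le_one hpos).2 (by linarith), mul_div_cancel₀ _ h⟩
    obtain ⟨r, hr0, hr1, hr⟩ := hratio
    refine ⟨fun T => if c ⊆ T ∧ ∀ d ∈ s, ¬ d ⊆ T then w T * r else w₁ T, ?_, ?_, ?_⟩
    · intro T
      dsimp only
      split_ifs
      · exact ⟨mul_nonneg (hw T) hr0, mul_le_of_le_one_right (hw T) hr1⟩
      · exact hb T
    · intro T hT
      have h1 := hT c hc
      simp only [h1, false_and, if_false]
      exact hsupp T fun d hd => hT d (Finset.mem_insert_of_mem hd)
    · intro d hd
      rcases Finset.mem_insert.1 hd with rfl | hd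
      · have : a d = A + (W d - B) * r := by linarith
        rw [this, ← hA, ← hB, Finset.sum_mul, ← Finset.sum_add_distrib]
        refine Finset.sum_congr rfl fun T _ => ?_
        by_cases hdT : d ⊆ T
        · by_cases hs : ∀ e ∈ s, ¬ e ⊆ T
          · simp [hdT, hsupp T hs]
          · simp [hdT, hs]
        · simp [hdT]
      · rw [← hsum d hd]
        refine Finset.sum_congr rfl fun T _ => ?_
        by_cases hdT : d ⊆ T
        · have : ¬ ∀ e ∈ s, ¬ e ⊆ T := fun h => h d hd hdT
          simp only [this, and_false, if_false]
        · simp [hdT]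

/-- Existence of a probability distribution on the subsets of `l` with prescribed upper masses
`ζ e`, `e ∈ F`, built by adding the elements of `l` one at a time. -/
theorem exists_weights (F : Finset (Finset α)) (ζ : Finset α → ℝ)
    (h1 : ζ ∅ = 1) (l : List α) (hl : l.Nodup)
    (herase : ∀ v t, v :: t <:+ l → ∀ e ∈ F, v ∈ e → e ⊆ (v :: t).toFinset → e.erase v ∈ F)
    (hchain : ∀ v t, v :: t <:+ l → ∀ e ∈ F, v ∈ e → e ⊆ (v :: t).toFinset →
      ∀ d ∈ F, v ∈ d → d ⊆ (v :: t).toFinset → e ⊆ d ∨ d ⊆ e)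
    (h0 : ∀ v t, v :: t <:+ l → ∀ e ∈ F, v ∈ e → e ⊆ (v :: t).toFinset →
      0 ≤ ζ e ∧ ζ e ≤ ζ (e.erase v))
    (hmono : ∀ v t, v :: t <:+ l → ∀ e ∈ F, v ∈ e → e ⊆ (v :: t).toFinset →
      ∀ d ∈ F, v ∈ d → d ⊆ (v :: t).toFinset → e ⊆ d →
        ζ d ≤ ζ e ∧ ζ (d.erase v) - ζ d ≤ ζ (e.erase v) - ζ e) :
    ∃ w : Finset α → ℝ, (∀ T, 0 ≤ w T) ∧ ∑ T ∈ l.toFinset.powerset, w T = 1 ∧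
      ∀ e ∈ F, e ⊆ l.toFinset →
        ∑ T ∈ l.toFinset.powerset, (if e ⊆ T then w T else 0) = ζ e := by
  induction l with
  | nil =>
    refine ⟨fun _ => 1, fun _ => zero_le_one, by simp, fun e _ he => ?_⟩
    obtain rfl : e = ∅ := by simpa using he
    simp [h1]
  | cons v l ih =>
    obtain ⟨hvl, hl'⟩ := List.nodup_cons.1 hl
    have suff : ∀ {u t}, u :: t <:+ l → u :: t <:+ v :: l :=
      fun h => h.trans (List.suffix_cons v l)
    obtain ⟨w, hw, hw1, hwF⟩ := ih hl' (fun u t h => herase u t (suff h))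
      (fun u t h => hchain u t (suff h)) (fun u t h => h0 u t (suff h))
      (fun u t h => hmono u t (suff h))
    have self : v :: l <:+ v :: l := List.suffix_rfl
    have hvV : v ∉ l.toFinset := by simpa using hvl
    have herl : ∀ {e : Finset α}, e ⊆ (v :: l).toFinset → e.erase v ⊆ l.toFinset := by
      intro e he x hx
      rw [Finset.mem_erase] at hx
      have := he hx.2
      simp only [List.toFinset_cons, Finset.mem_insert] at this
      exact this.resolve_left hx.1
    set D := F.filter fun e => v ∈ e ∧ e ⊆ (v :: l).toFinset with hD
    have hDm : ∀ {e}, e ∈ D → e ∈ F ∧ v ∈ e ∧ e ⊆ (v :: l).toFinset := by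
      intro e he; simpa [hD] using he
    obtain ⟨w₁, hb, -, hsum⟩ := exists_thinning l.toFinset.powerset w hw
      (fun c => ζ (insert v c)) ζ (D.image fun e => e.erase v)
      (by
        intro c hc
        obtain ⟨e, he, rfl⟩ := Finset.mem_image.1 hc
        obtain ⟨heF, hve, hel⟩ := hDm he
        exact hwF _ (herase v l self e heF hve hel) (herl hel))
      (by
        intro c hc d hd
        obtain ⟨e, he, rfl⟩ := Finset.mem_image.1 hc
        obtain ⟨g, hg, rfl⟩ := Finset.mem_image.1 hd
        obtain ⟨heF, hve, hel⟩ := hDm he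
        obtain ⟨hgF, hvg, hgl⟩ := hDm hg
        exact (hchain v l self e heF hve hel g hgF hvg hgl).imp
          (Finset.erase_subset_erase v) (Finset.erase_subset_erase v))
      (by
        intro c hc
        obtain ⟨e, he, rfl⟩ := Finset.mem_image.1 hc
        obtain ⟨heF, hve, hel⟩ := hDm he
        simpa only [Finset.insert_erase hve] using h0 v l self e heF hve hel)
      (by
        intro c hc d hd hcd
        obtain ⟨e, he, rfl⟩ := Finset.mem_image.1 hc
        obtain ⟨g, hg, rfl⟩ := Finset.mem_image.1 hd
        obtain ⟨heF, hve, hel⟩ := hDm he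
        obtain ⟨hgF, hvg, hgl⟩ := hDm hg
        have heg : e ⊆ g := by
          rw [← Finset.insert_erase hve, ← Finset.insert_erase hvg]
          exact Finset.insert_subset_insert v hcd
        simpa only [Finset.insert_erase hve, Finset.insert_erase hvg] using
          hmono v l self e heF hve hel g hgF hvg hgl heg)
    have hvT : ∀ T ∈ l.toFinset.powerset, v ∉ T := fun T hT h =>
      hvV (Finset.mem_powerset.1 hT h)
    refine ⟨fun T => if v ∈ T then w₁ (T.erase v) else w T - w₁ T, ?_, ?_, ?_⟩
    · intro T
      dsimp only
      split_ifs
      · exact (hb _).1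
      · linarith [(hb T).2]
    · rw [List.toFinset_cons, Finset.sum_powerset_insert hvV, ← Finset.sum_add_distrib, ← hw1]
      refine Finset.sum_congr rfl fun T hT => ?_
      simp [hvT T hT]
    · intro e heF hel
      rw [List.toFinset_cons, Finset.sum_powerset_insert hvV, ← Finset.sum_add_distrib]
      by_cases hve : v ∈ e
      · have := hsum (e.erase v) (Finset.mem_image_of_mem _ (Finset.mem_filter.2 ⟨heF, hve, hel⟩))
        rw [Finset.insert_erase hve] at this
        rw [← this]
        refine Finset.sum_congr rfl fun T hT => ?_
        have hT' := hvT T hT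
        have : ¬ e ⊆ T := fun h => hT' (h hve)
        simp [hT', this, Finset.subset_insert_iff]
      · have hel' : e ⊆ l.toFinset := by
          have := herl hel
          rwa [Finset.erase_eq_of_notMem hve] at this
        rw [← hwF e heF hel']
        refine Finset.sum_congr rfl fun T hT => ?_
        have hT' := hvT T hT
        by_cases heT : e ⊆ T <;> simp [hT', heT, Finset.subset_insert_iff_of_notMem hve]

theorem zc_of_two_le {β : Type*} (z : (β ⊕ Finset β) → ℝ) {p : Finset β} (hp : 2 ≤ p.card) :
    zc z p = z (Sum.inr p) := if_pos hp

theorem zc_singleton {β : Type*} (z : (β ⊕ Finset β) → ℝ) (u : β) : zc z {u} = z (Sum.inl u) := by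
  simp [zc]

theorem zc_combo {β : Type*} (x y : (β ⊕ Finset β) → ℝ) (a b : ℝ) (p : Finset β) :
    zc (a • x + b • y) p = a * zc x p + b * zc y p := by
  unfold zc
  split_ifs
  · simp
  · simp [Finset.sum_add_distrib, Finset.mul_sum]

theorem mem_eraseListE {E : Finset (Finset α)} {e : Finset α} (he : e ∈ E) (h2 : 2 ≤ e.card)
    (l : List α) (hl : ∀ x ∈ l, x ∉ e) : e ∈ eraseListE E l := by
  induction l generalizing E with
  | nil => exact he
  | cons v l ih =>
    refine ih ?_ fun x hx => hl x (List.mem_cons_of_mem _ hx)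
    rw [eraseE, Finset.mem_filter, Finset.mem_image]
    exact ⟨⟨e, he, Finset.erase_eq_of_notMem (hl v List.mem_cons_self)⟩, h2⟩

theorem eraseListV_subset (V : Finset α) (l : List α) : eraseListV V l ⊆ V := by
  induction l generalizing V with
  | nil => exact subset_rfl
  | cons v l ih => exact (ih (V.erase v)).trans (Finset.erase_subset v V)

/-- The vertex of the multilinear polytope of `(V, E)` given by the set `T` of nodes. -/
def vertexPoint (V : Finset α) (E : Finset (Finset α)) (T : Finset α) : (α ⊕ Finset α) → ℝ
  | Sum.inl u => if u ∈ V ∧ u ∈ T then 1 else 0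
  | Sum.inr e => if e ∈ E ∧ e ⊆ T then 1 else 0

theorem vertexPoint_mem {V : Finset α} {E : Finset (Finset α)} (hE : ∀ e ∈ E, e ⊆ V)
    (T : Finset α) : vertexPoint V E T ∈ mSet V E := by
  refine ⟨fun v hv => ?_, fun v hv => by simp [vertexPoint, hv],
    fun e he => by simp [vertexPoint, he], fun e he => ?_⟩
  · by_cases h : v ∈ T <;> simp [vertexPoint, hv, h]
  · have : ∏ v ∈ e, vertexPoint V E T (Sum.inl v) = ∏ v ∈ e, if v ∈ T then (1 : ℝ) else 0 :=
      Finset.prod_congr rfl fun v hv => by simp [vertexPoint, hE e he hv]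
    rw [this, Finset.prod_boole]
    simp [vertexPoint, he, Finset.subset_iff]

theorem mem_convexHull_of_weights {V : Finset α} {E : Finset (Finset α)} (hE : ∀ e ∈ E, e ⊆ V)
    (w : Finset α → ℝ) (hw : ∀ T, 0 ≤ w T) (hw1 : ∑ T ∈ V.powerset, w T = 1)
    (z : (α ⊕ Finset α) → ℝ) (hzV : ∀ u, u ∉ V → z (Sum.inl u) = 0)
    (hzE : ∀ e, e ∉ E → z (Sum.inr e) = 0)
    (hu : ∀ u ∈ V, ∑ T ∈ V.powerset, (if {u} ⊆ T then w T else 0) = z (Sum.inl u))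
    (he : ∀ e ∈ E, ∑ T ∈ V.powerset, (if e ⊆ T then w T else 0) = z (Sum.inr e)) :
    z ∈ convexHull ℝ (mSet V E) := by
  have hz : z = ∑ T ∈ V.powerset, w T • vertexPoint V E T := by
    funext x
    rw [Finset.sum_apply]
    rcases x with u | e
    · by_cases h : u ∈ V
      · rw [← hu u h]; simp [vertexPoint, h]
      · rw [hzV u h]; simp [vertexPoint, h]
    · by_cases h : e ∈ E
      · rw [← he e h]; simp [vertexPoint, h]
      · rw [hzE e h]; simp [vertexPoint, h]
  rw [hz]
  exact (convex_convexHull ℝ _).sum_mem (fun T _ => hw T) hw1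
    fun T _ => subset_convexHull ℝ _ (vertexPoint_mem hE T)

theorem zc_of_mem_mSet {V : Finset α} {E : Finset (Finset α)} {z : (α ⊕ Finset α) → ℝ}
    (hz : z ∈ mSet V E) {p : Finset α} (hpV : p ⊆ V) (hp : 2 ≤ p.card ∧ p ∈ E ∨ p.card = 1) :
    zc z p = if p ⊆ V.filter (fun u => z (Sum.inl u) = 1) then 1 else 0 := by
  obtain ⟨h01, -, -, hprod⟩ := hz
  have hval : ∀ u ∈ p, z (Sum.inl u) = if z (Sum.inl u) = 1 then 1 else 0 := by
    intro u hu
    rcases h01 u (hpV hu) with h | h <;> simp [h]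
  have key : zc z p = ∏ u ∈ p, z (Sum.inl u) := by
    rcases hp with ⟨h2, hpE⟩ | h1
    · rw [zc_of_two_le z h2, hprod p hpE]
    · obtain ⟨u, rfl⟩ := Finset.card_eq_one.1 h1
      simp [zc]
  rw [key, Finset.prod_congr rfl hval, Finset.prod_boole]
  congr 1
  simp only [Finset.subset_iff, Finset.mem_filter, eq_iff_iff]
  exact ⟨fun h u hu => ⟨hpV hu, h u hu⟩, fun h u hu => (h hu).2⟩

theorem nodup_get_eq_head {l pre t : List α} (hl : l.Nodup) {v : α} (h : pre ++ v :: t = l)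
    {e : Finset α} (hv : v ∈ e) (he : e ⊆ (v :: t).toFinset) (i : Fin l.length)
    (hi : l.get i ∈ e) (hmin : ∀ j : Fin l.length, j < i → l.get j ∉ e) : l.get i = v := by
  subst h
  have hlen : pre.length < (pre ++ v :: t).length := by simp
  rcases lt_trichotomy i.1 pre.length with hlt | heq | hgt
  · exfalso
    have hmem : (pre ++ v :: t).get i ∈ pre := by
      rw [List.get_eq_getElem, List.getElem_append_left hlt]
      exact List.getElem_mem hlt
    exact (List.nodup_append'.1 hl).2.2 hmem (List.mem_toFinset.1 (he hi))
  · simp [List.get_eq_getElem, heq]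
  · exfalso
    refine hmin ⟨pre.length, hlen⟩ hgt ?_
    simpa [List.get_eq_getElem] using hv

theorem exists_suffix_of_first {l : List α} {e : Finset α} (hel : e ⊆ l.toFinset)
    (i : Fin l.length) (hmin : ∀ j : Fin l.length, j < i → l.get j ∉ e) :
    ∃ t, l.get i :: t <:+ l ∧ e ⊆ (l.get i :: t).toFinset := by
  have hdrop : l.get i :: l.drop (i + 1) = l.drop i := by
    rw [List.get_eq_getElem, List.getElem_cons_drop]
  refine ⟨l.drop (i + 1), hdrop ▸ List.drop_suffix _ _, fun x hx => ?_⟩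
  rw [hdrop, List.mem_toFinset]
  have hxl := List.mem_toFinset.1 (hel hx)
  rw [← List.take_append_drop i l, List.mem_append] at hxl
  refine hxl.resolve_left fun h => ?_
  obtain ⟨j, hj, rfl⟩ := List.mem_iff_getElem.1 h
  rw [List.length_take] at hj
  refine hmin ⟨j, by omega⟩ (Fin.lt_def.2 (by simp; omega)) ?_
  simpa using hx

theorem IsExpanded.toFinset_eq {V : Finset α} {E : Finset (Finset α)} {l : List α}
    (hexp : IsExpanded V E l) (hlen : l.length = V.card) : l.toFinset = V := by
  refine Finset.eq_of_subset_of_card_le (fun x hx => ?_) ?_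
  · obtain ⟨i, rfl⟩ := List.mem_iff_get.1 (List.mem_toFinset.1 hx)
    exact eraseListV_subset V _ (hexp.1.2 i).1
  · rw [List.toFinset_card_of_nodup hexp.1.1, hlen]

theorem IsExpanded.erase_mem {V : Finset α} {E : Finset (Finset α)} {l : List α}
    (hexp : IsExpanded V E l) {v : α} {t : List α} (h : v :: t <:+ l) {e : Finset α}
    (he : e ∈ E) (het : e ⊆ (v :: t).toFinset) (hcard : 2 ≤ (e.erase v).card) :
    e.erase v ∈ E := by
  obtain ⟨pre, hpre⟩ := h
  have hnd := hexp.1.1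
  have htake : l.take (pre.length + 1) = pre ++ [v] := by
    rw [← hpre, List.take_append]; simp
  have heq : e \ (l.take (pre.length + 1)).toFinset = e.erase v := by
    ext x
    simp only [htake, Finset.mem_sdiff, Finset.mem_erase, List.mem_toFinset, List.mem_append,
      List.mem_singleton, not_or]
    refine ⟨fun hx => ⟨hx.2.2, hx.1⟩, fun hx => ⟨hx.2, fun hxp => ?_, hx.1⟩⟩
    rw [← hpre] at hnd
    exact (List.nodup_append'.1 hnd).2.2 hxp (List.mem_toFinset.1 (het hx.2))
  have := hexp.2 e he (pre.length + 1) (by rw [← hpre]; simp)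
  rw [heq] at this
  exact this hcard

theorem IsExpanded.chain {V : Finset α} {E : Finset (Finset α)} {l : List α}
    (hexp : IsExpanded V E l) (hE : ∀ e ∈ E, 2 ≤ e.card) {v : α} {t : List α}
    (h : v :: t <:+ l) {e d : Finset α}
    (he : e ∈ E) (hve : v ∈ e) (het : e ⊆ (v :: t).toFinset)
    (hd : d ∈ E) (hvd : v ∈ d) (hdt : d ⊆ (v :: t).toFinset) : e ⊆ d ∨ d ⊆ e := by
  obtain ⟨pre, hpre⟩ := h
  have hnd := hexp.1.1
  have hlt : pre.length < l.length := by rw [← hpre]; simp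
  have hget : l.get ⟨pre.length, hlt⟩ = v := by
    subst hpre; simp [List.get_eq_getElem]
  have htake : l.take pre.length = pre := by rw [← hpre]; simp
  have hsurv : ∀ g ∈ E, g ⊆ (v :: t).toFinset → g ∈ eraseListE E pre := by
    intro g hg hgt
    refine mem_eraseListE hg (hE g hg) pre fun x hx hxg => ?_
    rw [← hpre] at hnd
    exact (List.nodup_append'.1 hnd).2.2 hx (List.mem_toFinset.1 (hgt hxg))
  have hn := (hexp.1.2 ⟨pre.length, hlt⟩).2
  rw [hget, htake] at hn
  exact hn e (hsurv e he het) hve d (hsurv d hd hdt) hvd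

/-- the multilinear polytope of a β-acyclic hypergraph expanded w.r.t. an
ordering of all its nodes. -/
theorem beta_acyclic_expanded_polytope
    (V : Finset α) (E : Finset (Finset α)) (hG : IsHypergraph V E)
    (hacyc : IsBetaAcyclic E)
    (l : List α) (hlen : l.length = V.card) (hexp : IsExpanded V E l)
    (ve : Finset α → α)
    (hve : ∀ e ∈ E, ∃ i : Fin l.length, ve e = l.get i ∧ l.get i ∈ e ∧
      ∀ j : Fin l.length, j < i → l.get j ∉ e)
    (M : Finset (Finset α))
    (hM : M = E.filter fun e => ∃ g ∈ E, g ⊂ e ∧ ve e ∈ g)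
    (fe : Finset α → Finset α)
    (hfe : ∀ e ∈ M, fe e ∈ E ∧ fe e ⊂ e ∧ ve e ∈ fe e ∧
      ∀ g ∈ E, g ⊂ e → ve e ∈ g → g.card ≤ (fe e).card)
    (Ebar : Finset (Finset α))
    (hEbar : Ebar = E.filter fun f => ∀ g ∈ E, ¬ f ⊂ g) :
    convexHull ℝ (mSet V E) =
      { z | (∀ u, u ∉ V → z (Sum.inl u) = 0)
          ∧ (∀ f, f ∉ E → z (Sum.inr f) = 0)
          ∧ (∀ u ∈ V, 0 ≤ z (Sum.inl u) ∧ z (Sum.inl u) ≤ 1)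
          ∧ (∀ f ∈ Ebar, 0 ≤ z (Sum.inr f))
          ∧ (∀ f ∈ E, z (Sum.inr f) - zc z (f.erase (ve f)) ≤ 0)
          ∧ (∀ f ∈ M, z (Sum.inr f) - z (Sum.inr (fe f)) ≤ 0)
          ∧ (∀ f ∈ M, - zc z ((fe f).erase (ve f)) + zc z (f.erase (ve f))
              + z (Sum.inr (fe f)) - z (Sum.inr f) ≤ 0)
          ∧ (∀ f ∈ E \ M,
              z (Sum.inl (ve f)) + zc z (f.erase (ve f)) - z (Sum.inr f) ≤ 1)
          ∧ (∀ f ∈ E \ M, z (Sum.inr f) - z (Sum.inl (ve f)) ≤ 0) } := by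
  obtain ⟨hEV, hE2⟩ := hG
  have hl := hexp.1.1
  have hlV := hexp.toFinset_eq hlen
  have hvmem : ∀ e ∈ E, ve e ∈ e := fun e he => by
    obtain ⟨i, hi, hie, -⟩ := hve e he
    rwa [hi]
  have hsuff : ∀ e ∈ E, ∃ t, ve e :: t <:+ l ∧ e ⊆ (ve e :: t).toFinset := fun e he => by
    obtain ⟨i, hi, -, hmin⟩ := hve e he
    rw [hi]
    exact exists_suffix_of_first (hlV ▸ hEV e he) i hmin
  have hveq : ∀ v t, v :: t <:+ l → ∀ e ∈ E, v ∈ e → e ⊆ (v :: t).toFinset → ve e = v := by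
    rintro v t ⟨pre, hpre⟩ e he hv het
    obtain ⟨i, hi, hie, hmin⟩ := hve e he
    rw [hi]
    exact nodup_get_eq_head hl hpre hv het i hie hmin
  have hcard : ∀ e ∈ E, (e.erase (ve e)).card = e.card - 1 := fun e he =>
    Finset.card_erase_of_mem (hvmem e he)
  have herE : ∀ e ∈ E, 2 ≤ (e.erase (ve e)).card ∧ e.erase (ve e) ∈ E ∨
      (e.erase (ve e)).card = 1 := fun e he => by
    obtain ⟨t, ht, het⟩ := hsuff e he
    by_cases h2 : 2 ≤ (e.erase (ve e)).card
    · exact Or.inl ⟨h2, hexp.erase_mem ht he het h2⟩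
    · have := hcard e he
      have := hE2 e he
      exact Or.inr (by omega)
  have hMmem : ∀ e, e ∈ M ↔ e ∈ E ∧ ∃ g ∈ E, g ⊂ e ∧ ve e ∈ g := fun e => by
    rw [hM, Finset.mem_filter]
  have hvf : ∀ e ∈ M, ve (fe e) = ve e := fun e he => by
    obtain ⟨t, ht, het⟩ := hsuff e ((hMmem e).1 he).1
    obtain ⟨h1, h2, h3, -⟩ := hfe e he
    exact hveq _ t ht _ h1 h3 (h2.1.trans het)
  have hsubf : ∀ e ∈ M, ∀ g ∈ E, g ⊂ e → ve e ∈ g → g ⊆ fe e := fun e he g hg hge hvg => by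
    obtain ⟨t, ht, het⟩ := hsuff e ((hMmem e).1 he).1
    obtain ⟨h1, h2, h3, h4⟩ := hfe e he
    rcases hexp.chain hE2 ht hg hvg (hge.1.trans het) h1 h3 (h2.1.trans het) with h | h
    · exact h
    · exact (Finset.eq_of_subset_of_card_le h (h4 g hg hge hvg)).ge
  apply Set.Subset.antisymm
  · refine convexHull_min ?_ ?_
    · intro z hz
      set T := V.filter (fun u => z (Sum.inl u) = 1) with hT
      have hnode : ∀ u ∈ V, z (Sum.inl u) = if u ∈ T then 1 else 0 := fun u hu => by
        have := zc_of_mem_mSet hz (p := {u}) (by simpa using hu) (Or.inr (by simp))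
        simpa only [zc_singleton, Finset.singleton_subset_iff] using this
      have hedge : ∀ e ∈ E, z (Sum.inr e) = if e ⊆ T then 1 else 0 := fun e he => by
        have := zc_of_mem_mSet hz (hEV e he) (Or.inl ⟨hE2 e he, he⟩)
        rwa [zc_of_two_le z (hE2 e he)] at this
      have hpar : ∀ e ∈ E, zc z (e.erase (ve e)) = if e.erase (ve e) ⊆ T then 1 else 0 :=
        fun e he => zc_of_mem_mSet hz ((Finset.erase_subset _ _).trans (hEV e he)) (herE e he)
      have hsplit : ∀ e ∈ E, e ⊆ T ↔ ve e ∈ T ∧ e.erase (ve e) ⊆ T := fun e he => by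
        conv_lhs => rw [← Finset.insert_erase (hvmem e he)]
        exact Finset.insert_subset_iff
      have hedge' : ∀ e ∈ E, z (Sum.inr e) =
          if ve e ∈ T ∧ e.erase (ve e) ⊆ T then 1 else 0 := fun e he => by
        simp only [hedge e he, hsplit e he]
      refine ⟨hz.2.1, hz.2.2.1, fun u hu => ?_, fun f hf => ?_, fun f hf => ?_, fun f hf => ?_,
        fun f hf => ?_, fun f hf => ?_, fun f hf => ?_⟩
      · rw [hnode u hu]; split_ifs <;> norm_num
      · rw [hEbar, Finset.mem_filter] at hf
        rw [hedge f hf.1]; split_ifs <;> norm_num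
      · rw [hedge' f hf, hpar f hf]
        by_cases h1 : ve f ∈ T <;> by_cases h2 : f.erase (ve f) ⊆ T <;> simp [h1, h2]
      · obtain ⟨h1, h2, -⟩ := hfe f hf
        rw [hedge f ((hMmem f).1 hf).1, hedge _ h1]
        by_cases h : f ⊆ T
        · simp [h, h2.1.trans h]
        · simp only [h, if_false]; split_ifs <;> norm_num
      · obtain ⟨h1, h2, -⟩ := hfe f hf
        have hfE := ((hMmem f).1 hf).1
        have hf1 := hedge' _ h1
        have hf2 := hpar _ h1
        rw [hvf f hf] at hf1 hf2
        rw [hedge' f hfE, hpar f hfE, hf1, hf2]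
        have hs : f.erase (ve f) ⊆ T → (fe f).erase (ve f) ⊆ T :=
          (Finset.erase_subset_erase _ h2.1).trans
        by_cases h4 : f.erase (ve f) ⊆ T
        · by_cases h3 : ve f ∈ T <;> simp [h3, h4, hs h4]
        · by_cases h3 : ve f ∈ T <;> by_cases h5 : (fe f).erase (ve f) ⊆ T <;> simp [h3, h4, h5]
      · have hfE := (Finset.mem_sdiff.1 hf).1
        rw [hedge' f hfE, hpar f hfE, hnode _ (hEV f hfE (hvmem f hfE))]
        by_cases h1 : ve f ∈ T <;> by_cases h2 : f.erase (ve f) ⊆ T <;> simp [h1, h2]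
      · have hfE := (Finset.mem_sdiff.1 hf).1
        rw [hedge' f hfE, hnode _ (hEV f hfE (hvmem f hfE))]
        by_cases h1 : ve f ∈ T <;> by_cases h2 : f.erase (ve f) ⊆ T <;> simp [h1, h2]
    · rintro x ⟨x1, x2, x3, x4, x5, x6, x7, x8, x9⟩ y ⟨y1, y2, y3, y4, y5, y6, y7, y8, y9⟩
        a b ha hb hab
      simp only [Set.mem_ofPred_eq, zc_combo, Pi.add_apply, Pi.smul_apply, smul_eq_mul]
      refine ⟨fun u hu => ?_, fun f hf => ?_, fun u hu => ⟨?_, ?_⟩, fun f hf => ?_,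
        fun f hf => ?_, fun f hf => ?_, fun f hf => ?_, fun f hf => ?_, fun f hf => ?_⟩
      · simp [x1 u hu, y1 u hu]
      · simp [x2 f hf, y2 f hf]
      · exact add_nonneg (mul_nonneg ha (x3 u hu).1) (mul_nonneg hb (y3 u hu).1)
      · linarith [mul_le_mul_of_nonneg_left (x3 u hu).2 ha,
          mul_le_mul_of_nonneg_left (y3 u hu).2 hb]
      · exact add_nonneg (mul_nonneg ha (x4 f hf)) (mul_nonneg hb (y4 f hf))
      · linarith [mul_le_mul_of_nonneg_left (x5 f hf) ha, mul_le_mul_of_nonneg_left (y5 f hf) hb]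
      · linarith [mul_le_mul_of_nonneg_left (x6 f hf) ha, mul_le_mul_of_nonneg_left (y6 f hf) hb]
      · linarith [mul_le_mul_of_nonneg_left (x7 f hf) ha, mul_le_mul_of_nonneg_left (y7 f hf) hb]
      · linarith [mul_le_mul_of_nonneg_left (x8 f hf) ha, mul_le_mul_of_nonneg_left (y8 f hf) hb]
      · linarith [mul_le_mul_of_nonneg_left (x9 f hf) ha, mul_le_mul_of_nonneg_left (y9 f hf) hb]
  · rintro z ⟨z1, z2, z3, z4, z5, z6, z7, z8, z9⟩
    have hanti : ∀ n, ∀ g ∈ E, g.card = n → ∀ e ∈ E, e ⊆ g →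
        z (Sum.inr g) ≤ z (Sum.inr e) := by
      intro n
      induction n using Nat.strong_induction_on with
      | _ n ih =>
        rintro g hg rfl e he heg
        rcases heg.eq_or_ssubset with rfl | hss
        · exact le_rfl
        by_cases hv : ve g ∈ e
        · have hgM := (hMmem g).2 ⟨hg, e, he, hss, hv⟩
          obtain ⟨h1, h2, -⟩ := hfe g hgM
          have := ih _ (Finset.card_lt_card h2) _ h1 rfl e he (hsubf g hgM e he hss hv)
          linarith [z6 g hgM]
        · have hsub : e ⊆ g.erase (ve g) := Finset.subset_erase.2 ⟨heg, hv⟩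
          have h2 : 2 ≤ (g.erase (ve g)).card := (hE2 e he).trans (Finset.card_le_card hsub)
          have hmem : g.erase (ve g) ∈ E := by
            rcases herE g hg with h | h
            · exact h.2
            · omega
          have := ih _ (Finset.card_erase_lt_of_mem (hvmem g hg)) _ hmem rfl e he hsub
          have h5 := z5 g hg
          rw [zc_of_two_le z h2] at h5
          linarith
    have hpos : ∀ e ∈ E, 0 ≤ z (Sum.inr e) := fun e he => by
      obtain ⟨g, heg, hg⟩ := E.exists_le_maximal he
      have hgb : g ∈ Ebar := by
        rw [hEbar, Finset.mem_filter]
        exact ⟨hg.prop, fun d hd hgd => hgd.2 (hg.le_of_ge hd hgd.1)⟩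
      exact (z4 g hgb).trans (hanti _ g hg.prop rfl e he heg)
    have hmonoE : ∀ n, ∀ d ∈ E, d.card = n → ∀ e ∈ E, ve d ∈ e → e ⊆ d →
        z (Sum.inr d) ≤ z (Sum.inr e) ∧ zc z (d.erase (ve d)) - z (Sum.inr d) ≤
          zc z (e.erase (ve d)) - z (Sum.inr e) := by
      intro n
      induction n using Nat.strong_induction_on with
      | _ n ih =>
        rintro d hd rfl e he hv hed
        rcases hed.eq_or_ssubset with rfl | hss
        · exact ⟨le_rfl, le_rfl⟩
        have hdM := (hMmem d).2 ⟨hd, e, he, hss, hv⟩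
        obtain ⟨h1, h2, -⟩ := hfe d hdM
        have := ih _ (Finset.card_lt_card h2) _ h1 rfl e he (hvf d hdM ▸ hv)
          (hsubf d hdM e he hss hv)
        rw [hvf d hdM] at this
        have h6 := z6 d hdM
        have h7 := z7 d hdM
        constructor <;> linarith [this.1, this.2]
    have hmonoV : ∀ n, ∀ d ∈ E, d.card = n → z (Sum.inr d) ≤ z (Sum.inl (ve d)) ∧
        zc z (d.erase (ve d)) - z (Sum.inr d) ≤ 1 - z (Sum.inl (ve d)) := by
      intro n
      induction n using Nat.strong_induction_on with
      | _ n ih =>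
        rintro d hd rfl
        by_cases hdM : d ∈ M
        · obtain ⟨h1, h2, -⟩ := hfe d hdM
          have := ih _ (Finset.card_lt_card h2) _ h1 rfl
          rw [hvf d hdM] at this
          have h6 := z6 d hdM
          have h7 := z7 d hdM
          constructor <;> linarith [this.1, this.2]
        · have hd' := Finset.mem_sdiff.2 ⟨hd, hdM⟩
          have h8 := z8 d hd'
          have h9 := z9 d hd'
          constructor <;> linarith
    set F : Finset (Finset α) := insert ∅ (V.image (fun u => {u}) ∪ E) with hF
    have hFE : ∀ e ∈ E, e ∈ F := fun e he => by simp [hF, he]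
    have hFV : ∀ u ∈ V, {u} ∈ F := fun u hu => by simp [hF, hu]
    have hFcases : ∀ e ∈ F, ∀ v ∈ e, e = {v} ∧ v ∈ V ∨ e ∈ E := by
      intro e he v hv
      simp only [hF, Finset.mem_insert, Finset.mem_union, Finset.mem_image] at he
      rcases he with rfl | ⟨u, hu, rfl⟩ | he
      · simp at hv
      · obtain rfl := Finset.mem_singleton.1 hv
        exact Or.inl ⟨rfl, hu⟩
      · exact Or.inr he
    set ζ : Finset α → ℝ := fun e => if e = ∅ then 1 else zc z e with hζ
    have hζne : ∀ {e : Finset α}, e.Nonempty → ζ e = zc z e := fun h => if_neg h.ne_empty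
    have hζE : ∀ e ∈ E, ζ e = z (Sum.inr e) := fun e he => by
      have h2 := hE2 e he
      rw [hζne (Finset.card_pos.1 (by omega)), zc_of_two_le z h2]
    have hζV : ∀ u, ζ {u} = z (Sum.inl u) := fun u => by
      rw [hζne (Finset.singleton_nonempty u), zc_singleton]
    have hζ0 : ζ ∅ = 1 := if_pos rfl
    have hζp : ∀ e ∈ E, ζ (e.erase (ve e)) = zc z (e.erase (ve e)) := fun e he =>
      hζne (Finset.card_pos.1 (by rcases herE e he with h | h <;> omega))
    obtain ⟨w, hw, hw1, hwF⟩ := exists_weights F ζ hζ0 l hl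
      (by
        intro v t ht e he hv het
        rcases hFcases e he v hv with ⟨rfl, -⟩ | heE
        · simp [hF]
        · have hvv := hveq v t ht e heE hv het
          have := herE e heE
          rw [hvv] at this
          rcases this with h | h
          · exact hFE _ h.2
          · obtain ⟨u, hu⟩ := Finset.card_eq_one.1 h
            rw [hu]
            refine hFV u (hEV e heE (Finset.erase_subset v e ?_))
            rw [hu]; exact Finset.mem_singleton_self u)
      (by
        intro v t ht e he hv het d hd hvd hdt
        rcases hFcases e he v hv with ⟨rfl, -⟩ | heE
        · exact Or.inl (Finset.singleton_subset_iff.2 hvd)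
        rcases hFcases d hd v hvd with ⟨rfl, -⟩ | hdE
        · exact Or.inr (Finset.singleton_subset_iff.2 hv)
        exact hexp.chain hE2 ht heE hv het hdE hvd hdt)
      (by
        intro v t ht e he hv het
        rcases hFcases e he v hv with ⟨rfl, hvV⟩ | heE
        · rw [hζV, Finset.erase_singleton, hζ0]
          exact z3 v hvV
        · have hvv := hveq v t ht e heE hv het
          rw [← hvv, hζE e heE, hζp e heE]
          exact ⟨hpos e heE, by linarith [z5 e heE]⟩)
      (by
        intro v t ht e he hv het d hd hvd hdt hed
        rcases hFcases d hd v hvd with ⟨rfl, hvV⟩ | hdE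
        · obtain rfl : e = {v} := hed.antisymm (Finset.singleton_subset_iff.2 hv)
          exact ⟨le_rfl, le_rfl⟩
        have hdv := hveq v t ht d hdE hvd hdt
        subst hdv
        rcases hFcases e he _ hv with ⟨rfl, hvV⟩ | heE
        · rw [hζV, Finset.erase_singleton, hζ0, hζE d hdE, hζp d hdE]
          exact hmonoV _ d hdE rfl
        · have hev := hveq _ t ht e heE hv het
          have := hζp e heE
          rw [hev] at this
          rw [this, hζE d hdE, hζp d hdE, hζE e heE]
          exact hmonoE _ d hdE rfl e heE hv hed)
    rw [hlV] at hw1 hwF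
    refine mem_convexHull_of_weights hEV w hw hw1 z z1 z2 (fun u hu => ?_) (fun e he => ?_)
    · rw [hwF {u} (hFV u hu) (Finset.singleton_subset_iff.2 hu), hζV]
    · rw [hwF e (hFE e he) (hEV e he), hζE e he]
end
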